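/- Let V be a valuation ring and n ≥ 3. Then SLₙ(V[x]) = Eₙ(V[x]); moreover, every σ(x) ∈ SLₙ(V[x]) is congruent to σ(0) modulo Eₙ(V[x]), i.e., there exists E ∈ Eₙ(V[x]) with σ(x)·E = σ(0). -/

import Mathlib

open Matrix Polynomial

/-- The set of elementary matrices (transvections) over a commutative ring. -/
def ElemSet (ι R : Type) [Fintype ι] [DecidableEq ι] [CommRing R] :
    Set (Matrix ι ι R) :=
  { M | ∃ i j : ι, ∃ a : R, i ≠ j ∧ M = Matrix.transvection i j a }

/-- The elementary subgroup `E_n(R)`, as the multiplicative closure of the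
elementary matrices (it is closed under inverses, hence a group). -/
def Elem (ι R : Type) [Fintype ι] [DecidableEq ι] [CommRing R] :
    Submonoid (Matrix ι ι R) :=
  Submonoid.closure (ElemSet ι R)

/-- A row is unimodular if its entries generate the unit ideal. -/
def IsUnimodular {ι R : Type} [CommRing R] (v : ι → R) : Prop :=
  Ideal.span (Set.range v) = ⊤

/-- Two rows are equivalent under the elementary group if one is obtained from
the other by right multiplication by an element of `E_n(R)`. -/
def RowEquivE {ι R : Type} [Fintype ι] [DecidableEq ι] [CommRing R]
    (v w : ι → R) : Prop :=
  ∃ E ∈ Elem ι R, Matrix.vecMul v E = w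

namespace Elem

section Matrices

variable {ι κ R : Type} [Fintype ι] [DecidableEq ι] [Fintype κ] [DecidableEq κ] [CommRing R]

theorem transvection_mem {i j : ι} (h : i ≠ j) (a : R) : transvection i j a ∈ Elem ι R :=
  Submonoid.subset_closure ⟨i, j, a, h, rfl⟩

theorem det_eq_one {M : Matrix ι ι R} (hM : M ∈ Elem ι R) : M.det = 1 := by
  induction hM using Submonoid.closure_induction with
  | mem x hx =>
    obtain ⟨i, j, a, h, rfl⟩ := hx
    exact det_transvection_of_ne i j h a
  | one => simp
  | mul x y _ _ hx hy => simp [hx, hy]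

theorem inv_mem {M : Matrix ι ι R} (hM : M ∈ Elem ι R) : M⁻¹ ∈ Elem ι R := by
  induction hM using Submonoid.closure_induction with
  | mem x hx =>
    obtain ⟨i, j, a, h, rfl⟩ := hx
    rw [inv_eq_right_inv (B := transvection i j (-a))]
    · exact transvection_mem h _
    · simp [transvection_mul_transvection_same i j h]
  | one => simp
  | mul x y _ _ hx hy => rw [Matrix.mul_inv_rev]; exact mul_mem hy hx

theorem of_mul_mem_right {M E : Matrix ι ι R} (hE : E ∈ Elem ι R) (h : M * E ∈ Elem ι R) :
    M ∈ Elem ι R := by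
  have := mul_mem h (inv_mem hE)
  rwa [Matrix.mul_assoc, mul_nonsing_inv _ (by simp [det_eq_one hE]), Matrix.mul_one] at this

theorem of_mul_mem_left {M E : Matrix ι ι R} (hE : E ∈ Elem ι R) (h : E * M ∈ Elem ι R) :
    M ∈ Elem ι R := by
  have := mul_mem (inv_mem hE) h
  rwa [← Matrix.mul_assoc, nonsing_inv_mul _ (by simp [det_eq_one hE]), Matrix.one_mul] at this

theorem transpose_mem {M : Matrix ι ι R} (hM : M ∈ Elem ι R) : Mᵀ ∈ Elem ι R := by
  induction hM using Submonoid.closure_induction with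
  | mem x hx =>
    obtain ⟨i, j, a, h, rfl⟩ := hx
    simpa [transvection] using transvection_mem h.symm a
  | one => simp
  | mul x y _ _ hx hy => rw [transpose_mul]; exact mul_mem hy hx

theorem submatrix_mem (e : Equiv.Perm ι) {M : Matrix ι ι R} (hM : M ∈ Elem ι R) :
    M.submatrix e e ∈ Elem ι R := by
  induction hM using Submonoid.closure_induction with
  | mem x hx =>
    obtain ⟨i, j, a, h, rfl⟩ := hx
    have := transvection_mem (e.symm.injective.ne h) a
    simpa [transvection, submatrix_add] using this
  | one => simp
  | mul x y _ _ hx hy =>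
    rw [← submatrix_mul_equiv x y e e e]; exact mul_mem hx hy

/-- The matrix adding `c k` times the entry at `i` to the entry at `k`, for all `k ≠ i`. -/
theorem one_add_sum_single_mem (i : ι) (c : ι → R) (T : Finset ι) (hT : i ∉ T) :
    1 + ∑ k ∈ T, single i k (c k) ∈ Elem ι R := by
  induction T using Finset.induction_on with
  | empty => simp
  | insert j T hj ih =>
    rw [Finset.mem_insert, not_or] at hT
    have := mul_mem (ih hT.2) (transvection_mem hT.1 (c j))
    convert this using 1
    have h0 : ∑ k ∈ T, single i k (c k) * single i j (c j) = 0 :=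
      Finset.sum_eq_zero fun k hk =>
        single_mul_single_of_ne (c := c k) i k i (ne_of_mem_of_not_mem hk hT.2) (c j)
    rw [transvection, Matrix.mul_add, Matrix.mul_one, Matrix.add_mul, Matrix.one_mul,
      Finset.sum_mul, h0, Finset.sum_insert hj]
    abel

/-- The identity extended along an injection of index sets. -/
def extend (f : κ → ι) (M : Matrix κ κ R) : Matrix ι ι R :=
  1 + (1 : Matrix ι ι R).submatrix id f * (M - 1) * (1 : Matrix ι ι R).submatrix f id

omit [Fintype κ] in
theorem submatrix_one_mul_submatrix_one {f : κ → ι} (hf : f.Injective) :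
    (1 : Matrix ι ι R).submatrix f id * (1 : Matrix ι ι R).submatrix id f = 1 := by
  rw [← submatrix_mul _ _ _ _ _ Function.bijective_id, Matrix.one_mul, submatrix_one f hf]

theorem extend_mul {f : κ → ι} (hf : f.Injective) (M N : Matrix κ κ R) :
    extend f (M * N) = extend f M * extend f N := by
  have h := submatrix_one_mul_submatrix_one (R := R) hf
  unfold extend
  set U := (1 : Matrix ι ι R).submatrix id f
  set W := (1 : Matrix ι ι R).submatrix f id
  have : U * (M - 1) * W * (U * (N - 1) * W) = U * ((M - 1) * (N - 1)) * W := by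
    calc _ = U * (M - 1) * (W * U) * (N - 1) * W := by simp only [Matrix.mul_assoc]
      _ = _ := by rw [h]; simp only [Matrix.mul_assoc, Matrix.one_mul]
  rw [Matrix.mul_add, Matrix.add_mul, Matrix.add_mul, this]
  have h2 : M * N - 1 = (M - 1) + (N - 1) + (M - 1) * (N - 1) := by noncomm_ring
  rw [h2]
  simp only [Matrix.mul_add, Matrix.add_mul, Matrix.one_mul, Matrix.mul_one]
  abel

theorem det_extend {f : κ → ι} (hf : f.Injective) (M : Matrix κ κ R) :
    (extend f M).det = M.det := by
  rw [extend, Matrix.mul_assoc, det_one_add_mul_comm, Matrix.mul_assoc,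
    submatrix_one_mul_submatrix_one hf]
  simp

theorem extend_mem {f : κ → ι} (hf : f.Injective) {M : Matrix κ κ R} (hM : M ∈ Elem κ R) :
    extend f M ∈ Elem ι R := by
  induction hM using Submonoid.closure_induction with
  | mem x hx =>
    obtain ⟨i, j, a, h, rfl⟩ := hx
    convert transvection_mem (hf.ne h) a
    simp only [extend, transvection, add_sub_cancel_left]
    congr 1
    ext a b
    simp [mul_apply, single, one_apply, Finset.sum_ite, ite_and]
    grind
  | one => simp [extend]
  | mul x y _ _ hx hy => rw [extend_mul hf]; exact mul_mem hx hy

theorem extend_succ {m : ℕ} (M : Matrix (Fin (m + 1)) (Fin (m + 1)) R)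
    (hrow : M 0 = Pi.single 0 1) (hcol : ∀ j, j ≠ 0 → M j 0 = 0) :
    M = extend Fin.succ (M.submatrix Fin.succ Fin.succ) := by
  ext a b
  refine Fin.cases ?_ (fun a => ?_) a <;> refine Fin.cases ?_ (fun b => ?_) b <;>
    simp [extend, mul_apply, one_apply, hrow, hcol, Fin.succ_ne_zero, (Fin.succ_ne_zero _).symm,
      Finset.sum_ite_eq]

end Matrices

end Elem

section Rows

variable {ι R : Type} [Fintype ι] [DecidableEq ι] [CommRing R]

theorem RowEquivE.trans {u v w : ι → R} (h : RowEquivE u v) (h' : RowEquivE v w) :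
    RowEquivE u w := by
  obtain ⟨E, hE, rfl⟩ := h
  obtain ⟨F, hF, rfl⟩ := h'
  exact ⟨E * F, mul_mem hE hF, by rw [vecMul_vecMul]⟩

omit [DecidableEq ι] in
theorem isUnimodular_iff {v : ι → R} : IsUnimodular v ↔ ∃ u, v ⬝ᵥ u = 1 := by
  rw [IsUnimodular, Ideal.eq_top_iff_one, Ideal.mem_span_range_iff_exists_fun]
  simp only [dotProduct, mul_comm]

theorem IsUnimodular.of_rowEquivE {v w : ι → R} (hv : IsUnimodular v) (h : RowEquivE v w) :
    IsUnimodular w := by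
  obtain ⟨E, hE, rfl⟩ := h
  obtain ⟨u, hu⟩ := isUnimodular_iff.1 hv
  refine isUnimodular_iff.2 ⟨E⁻¹ *ᵥ u, ?_⟩
  rw [← dotProduct_mulVec, mulVec_mulVec, mul_nonsing_inv _ (by simp [Elem.det_eq_one hE]),
    one_mulVec, hu]

theorem vecMul_single_apply (v : ι → R) (i j k : ι) (a : R) :
    (v ᵥ* single i j a) k = if j = k then v i * a else 0 := by
  simp [vecMul, dotProduct, single_apply, ite_and]

theorem rowEquivE_update (v : ι → R) {i j : ι} (h : i ≠ j) (a : R) :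
    RowEquivE v (Function.update v j (v j + a * v i)) := by
  refine ⟨transvection i j a, Elem.transvection_mem h a, ?_⟩
  ext k
  rw [transvection, vecMul_add, vecMul_one, Pi.add_apply, vecMul_single_apply]
  by_cases hk : k = j
  · subst hk; simp [mul_comm]
  · simp [hk, Ne.symm hk]

theorem rowEquivE_add_smul (v : ι → R) (i : ι) (c : ι → R) (hc : c i = 0) :
    RowEquivE v (fun k => v k + c k * v i) := by
  refine ⟨_, Elem.one_add_sum_single_mem i c (Finset.univ.erase i) (by simp), ?_⟩
  ext k
  rw [vecMul_add, vecMul_one, Pi.add_apply, vecMul_sum, Finset.sum_apply]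
  simp only [vecMul_single_apply]
  by_cases hk : k = i
  · subst hk
    simp [hc]
  · simp [hk, mul_comm]

/-- A unit `u` modulo `v i` may be moved from one of the other entries to another one. -/
theorem rowEquivE_scale (v : ι → R) {i j k : ι} (hij : i ≠ j) (hik : i ≠ k) (hjk : j ≠ k)
    {u w z : R} (h : u * w + v i * z = 1) :
    RowEquivE v (Function.update (Function.update v j (u * v j)) k (w * v k)) := by
  set row : R → R → ι → R := fun b c => Function.update (Function.update v j b) k c with hrow
  have hadd_k (b c a c' : R) (h : c' = c + a * b) : RowEquivE (row b c) (row b c') := by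
    simpa [hrow, hjk, h] using rowEquivE_update (row b c) hjk a
  have hadd_j (b c a b' : R) (h : b' = b + a * c) : RowEquivE (row b c) (row b' c) := by
    have := rowEquivE_update (row b c) hjk.symm a
    simpa [hrow, hjk, h, Function.update_comm hjk.symm] using this
  have hred_j (b c a b' : R) (h : b' = b + a * v i) : RowEquivE (row b c) (row b' c) := by
    have := rowEquivE_update (row b c) hij a
    simpa [hrow, hjk, hij, hik, h, Function.update_comm hjk.symm] using this
  have hred_k (b c a c' : R) (h : c' = c + a * v i) : RowEquivE (row b c) (row b c') := by
    simpa [hrow, hjk, hij, hik, h] using rowEquivE_update (row b c) hik a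
  have key (b c : R) : RowEquivE (row b c) (row (u * b) (w * c)) := by
    have h₁ := hadd_k b c u _ rfl
    have h₂ := hadd_j b (c + u * b) (-w) _ rfl
    have h₃ := hred_j (b + -w * (c + u * b)) (c + u * b) (-z * b) (-w * c)
      (by linear_combination b * h)
    have h₄ := hadd_k (-w * c) (c + u * b) u _ rfl
    have h₅ := hred_k (-w * c) (c + u * b + u * (-w * c)) (-z * c) (u * b)
      (by linear_combination c * h)
    have h₆ := hadd_k (-w * c) (u * b) (-1) (u * b + w * c) (by ring)
    have h₇ := hadd_j (-w * c) (u * b + w * c) 1 (u * b) (by ring)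
    have h₈ := hadd_k (u * b) (u * b + w * c) (-1) (w * c) (by ring)
    exact h₁.trans (h₂.trans (h₃.trans (h₄.trans (h₅.trans (h₆.trans (h₇.trans h₈))))))
  simpa [hrow] using key (v j) (v k)

end Rows

section ValuationRing

variable {V : Type} [CommRing V]

theorem isLocalRing_of_dvd_total [Nontrivial V] (hV : ∀ a b : V, a ∣ b ∨ b ∣ a) :
    IsLocalRing V := by
  refine .of_isUnit_or_isUnit_of_isUnit_add fun a b hab => ?_
  rcases hV a b with h | h
  · exact .inl (isUnit_of_dvd_unit ((dvd_add_right dvd_rfl).2 h) hab)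
  · exact .inr (isUnit_of_dvd_unit ((dvd_add_left dvd_rfl).2 h) hab)

theorem Finset.exists_forall_dvd {α : Type} (hV : ∀ a b : V, a ∣ b ∨ b ∣ a) {T : Finset α}
    (hT : T.Nonempty) (f : α → V) : ∃ a ∈ T, ∀ b ∈ T, f a ∣ f b := by
  induction hT using Finset.Nonempty.cons_induction with
  | singleton a => exact ⟨a, by simp, by simp⟩
  | cons a T ha hT ih =>
    obtain ⟨b, hb, hbT⟩ := ih
    simp only [Finset.mem_cons, forall_eq_or_imp, exists_eq_or_imp]
    rcases hV (f a) (f b) with h | h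
    · exact .inl ⟨dvd_rfl, fun c hc => h.trans (hbT c hc)⟩
    · exact .inr ⟨b, hb, h, hbT⟩

/-- Over a valuation ring, the content of a finite family of polynomials is the content of one of
its members, and that member is the product of its content and of a primitive polynomial. -/
theorem Polynomial.exists_content {α : Type} (hV : ∀ a b : V, a ∣ b ∨ b ∣ a) {T : Finset α}
    (hT : T.Nonempty) (h : α → V[X]) {d : ℕ} (hd : ∀ a ∈ T, (h a).natDegree < d) :
    ∃ c : V, (∀ a ∈ T, C c ∣ h a) ∧ ∃ a ∈ T, ∃ g l, h a = C c * g ∧ g.natDegree < d ∧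
      IsUnit (g.coeff l) := by
  classical
  obtain ⟨a₀, ha₀⟩ := hT
  have hd0 : 0 < d := (Nat.zero_le _).trans_lt (hd _ ha₀)
  obtain ⟨⟨a, l⟩, hal, hmin⟩ := Finset.exists_forall_dvd hV
    (T := T ×ˢ Finset.range d) ⟨(a₀, 0), by simp [ha₀, hd0]⟩ fun x => (h x.1).coeff x.2
  simp only [Finset.mem_product, Finset.mem_range, and_imp, Prod.forall] at hal hmin
  have hdvd : ∀ b ∈ T, ∀ m, (h a).coeff l ∣ (h b).coeff m := by
    intro b hb m
    by_cases hm : m < d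
    · exact hmin b m hb hm
    · rw [coeff_eq_zero_of_natDegree_lt ((hd b hb).trans_le (not_lt.1 hm))]
      exact dvd_zero _
  refine ⟨_, fun b hb => (C_dvd_iff_dvd_coeff _ _).2 (hdvd b hb), a, hal.1, ?_⟩
  choose q hq using hdvd a hal.1
  have hcoeff (m : ℕ) : (∑ k ∈ Finset.range d, monomial k (if k = l then 1 else q k)).coeff m =
      if m < d then (if m = l then 1 else q m) else 0 := by
    simp [coeff_monomial]
  refine ⟨∑ k ∈ Finset.range d, monomial k (if k = l then 1 else q k), l, ?_, ?_, ?_⟩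
  · ext m
    rw [coeff_C_mul, hcoeff]
    by_cases hm : m < d
    · by_cases hml : m = l
      · subst hml; simp [hm]
      · simp [hm, hml, ← hq]
    · simp [hm, coeff_eq_zero_of_natDegree_lt ((hd a hal.1).trans_le (not_lt.1 hm))]
  · refine (Nat.lt_iff_le_pred hd0).2 (natDegree_le_iff_coeff_eq_zero.2 fun m hm => ?_)
    rw [hcoeff, if_neg (by omega)]
  · simp [hcoeff, hal.2]

/-- Division by a polynomial with invertible constant term, along increasing powers. -/
theorem Polynomial.exists_eq_mul_add_X_pow_mul {p : V[X]} (hp : IsUnit (p.coeff 0))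
    (hd : 0 < p.natDegree) (N : ℕ) (g : V[X]) (hg : g.natDegree < N + p.natDegree) :
    ∃ q r, g = p * q + X ^ N * r ∧ r.natDegree < p.natDegree := by
  induction N generalizing g with
  | zero => exact ⟨0, g, by simp, by simpa using hg⟩
  | succ N ih =>
    obtain ⟨u, hu⟩ := hp.exists_right_inv
    set g' := (g - p * C (u * g.coeff 0)).divX with hg'
    have hgX : g = p * C (u * g.coeff 0) + X * g' := by
      have := divX_mul_X_add (g - p * C (u * g.coeff 0))
      rw [coeff_sub, coeff_mul_C, ← mul_assoc, hu, one_mul, sub_self, C_0, add_zero, ← hg'] at this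
      linear_combination -this
    have hdeg : g'.natDegree < N + p.natDegree := by
      rw [hg', natDegree_divX_eq_natDegree_tsub_one]
      have h₁ := natDegree_sub_le g (p * C (u * g.coeff 0))
      have h₂ := natDegree_mul_C_le p (u * g.coeff 0)
      omega
    obtain ⟨q, r, hqr, hr⟩ := ih g' hdeg
    refine ⟨C (u * g.coeff 0) + X * q, r, ?_, hr⟩
    linear_combination hgX + X * hqr

/-- The Euclidean descent: a pair consisting of a polynomial with invertible constant term and of
a primitive polynomial of smaller degree can be reduced so as to lower the degree of the former. -/
theorem Polynomial.descent [IsLocalRing V] (hV : ∀ a b : V, a ∣ b ∨ b ∣ a)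
    (P : V[X] → V[X] → Prop)
    (hadd_right : ∀ p g t, P p (g + p * t) → P p g)
    (hadd_left : ∀ p g t, P (p + g * t) g → P p g)
    (hX : ∀ p g, IsUnit (p.coeff 0) → P p (X * g) → P p g)
    (d : ℕ) (ih : ∀ p g, IsUnit (p.coeff 0) → p.natDegree < d → P p g)
    (p g : V[X]) (hp : IsUnit (p.coeff 0)) (hpd : p.natDegree = d) (hg : g.natDegree < d)
    (l : ℕ) (hl : IsUnit (g.coeff l)) : P p g := by
  have hXpow (k : ℕ) (g : V[X]) (h : P p (X ^ k * g)) : P p g := by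
    induction k with
    | zero => simpa using h
    | succ k ihk => exact ihk (hX _ _ hp (by rwa [← mul_assoc, ← pow_succ']))
  induction hn : d - l using Nat.strong_induction_on generalizing g l with
  | _ n ihn =>
    obtain ⟨k, hk0, hk⟩ : ∃ k, 0 < k ∧ d = g.natDegree + k := ⟨d - g.natDegree, by omega, by omega⟩
    have hld : l ≤ g.natDegree := le_natDegree_of_ne_zero hl.ne_zero
    have hlow (f h : V[X]) (hf : f.natDegree ≤ d) (hh : h.natDegree ≤ d)
        (hfh : f.coeff d = h.coeff d) : (f - h).natDegree < d := by
      refine (Nat.lt_iff_le_pred (by omega)).2 (natDegree_le_iff_coeff_eq_zero.2 fun m hm => ?_)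
      rcases eq_or_ne m d with rfl | hmd
      · simp [hfh]
      · rw [coeff_sub, coeff_eq_zero_of_natDegree_lt (by omega),
          coeff_eq_zero_of_natDegree_lt (by omega), sub_zero]
    have hXg : (X ^ k * g).natDegree ≤ d := by
      refine natDegree_mul_le.trans ?_
      rw [natDegree_X_pow]; omega
    have hXgd : (X ^ k * g).coeff d = g.leadingCoeff := by
      rw [hk, coeff_X_pow_mul, leadingCoeff]
    have hpl : p.coeff d = p.leadingCoeff := by rw [leadingCoeff, hpd]
    by_cases hdvd : g.leadingCoeff ∣ p.leadingCoeff
    · obtain ⟨t, ht⟩ := hdvd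
      refine hadd_left p g (-(X ^ k * C t)) (ih _ _ ?_ ?_)
      · have : (X ^ k * C t * g).coeff 0 = 0 := by
          rw [mul_assoc, coeff_X_pow_mul', if_neg (by omega)]
        rw [mul_neg, coeff_add, coeff_neg, mul_comm, this, neg_zero, add_zero]
        exact hp
      · have : p + g * -(X ^ k * C t) = p - X ^ k * g * C t := by ring
        rw [this]
        refine hlow _ _ hpd.le ((natDegree_mul_C_le _ _).trans hXg) ?_
        rw [coeff_mul_C, hXgd, hpl, ht]
    · obtain ⟨t, ht⟩ := (hV _ _).resolve_left hdvd
      have htu : ¬ IsUnit t := by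
        rintro ⟨u, rfl⟩
        exact hdvd ⟨(u⁻¹ : Vˣ), by rw [ht, mul_assoc, Units.mul_inv, mul_one]⟩
      refine hXpow k g (hadd_right _ _ (-C t) ?_)
      have heq : X ^ k * g + p * -C t = X ^ k * g - p * C t := by ring
      have hdeg : (X ^ k * g - p * C t).natDegree < d := by
        refine hlow _ _ hXg ((natDegree_mul_C_le _ _).trans hpd.le) ?_
        rw [hXgd, coeff_mul_C, hpl, ht]
      have hunit : IsUnit ((X ^ k * g - p * C t).coeff (l + k)) := by
        rw [coeff_sub, coeff_X_pow_mul, coeff_mul_C]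
        by_contra hcon
        refine (mem_nonunits_iff.1 ?_) hl
        have := IsLocalRing.nonunits_add (a := g.coeff l - p.coeff (l + k) * t)
          (b := p.coeff (l + k) * t) hcon (fun h => htu (isUnit_of_mul_isUnit_right h))
        simpa using this
      rw [heq]
      exact ihn (d - (l + k)) (by omega) _ hdeg _ hunit rfl

end ValuationRing

section UnimodularRows

variable {V ι : Type} [CommRing V] [Fintype ι] [DecidableEq ι]

theorem rowEquivE_single_of_isUnit {v : ι → V} {i j : ι} (hij : i ≠ j) (h : IsUnit (v i)) :
    RowEquivE v (Pi.single i 1) := by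
  obtain ⟨u, hu⟩ := h.exists_right_inv
  have h₁ := rowEquivE_update v hij (u * (1 - v j))
  have h₂ := rowEquivE_update (Function.update v j (v j + u * (1 - v j) * v i)) hij.symm (1 - v i)
  refine (h₁.trans h₂).trans ?_
  set w := Function.update (Function.update v j (v j + u * (1 - v j) * v i)) i _ with hw
  have hwi : w i = 1 := by
    simp only [hw, Function.update_self, Function.update_of_ne hij]
    linear_combination (1 - v i) * (1 - v j) * hu
  have h₃ := rowEquivE_add_smul w i (fun k => if k = i then 0 else - w k) (by simp)
  convert h₃ using 1
  ext k
  by_cases hk : k = i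
  · subst hk; simp [hwi]
  · simp [hk, hwi]

omit [Fintype ι] [DecidableEq ι] in
theorem IsUnimodular.exists_isUnit [IsLocalRing V] {v : ι → V} (hv : IsUnimodular v) :
    ∃ i, IsUnit (v i) := by
  by_contra! h
  refine IsLocalRing.maximalIdeal.isMaximal V |>.ne_top ((eq_top_iff.2 ?_))
  rw [← (show Ideal.span (Set.range v) = ⊤ from hv), Ideal.span_le]
  rintro _ ⟨i, rfl⟩
  exact h i

/-- If all entries but `v i` are divisible by `c`, then `v i` is comaximal with `c`. -/
theorem IsUnimodular.isCoprime {v : ι → V} (hv : IsUnimodular v) {i : ι} {c : V}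
    (hc : ∀ k ≠ i, c ∣ v k) : IsCoprime (v i) c := by
  obtain ⟨u, hu⟩ := isUnimodular_iff.1 hv
  rw [dotProduct, ← Finset.add_sum_erase _ _ (Finset.mem_univ i)] at hu
  obtain ⟨w, hw⟩ : c ∣ ∑ k ∈ Finset.univ.erase i, v k * u k :=
    Finset.dvd_sum fun k hk => (hc k (Finset.ne_of_mem_erase hk)).mul_right _
  exact ⟨u i, w, by rw [← hu, hw]; ring⟩

theorem rowEquivE_single_of_isUnit_coeff_zero [IsLocalRing V]
    (hV : ∀ a b : V, a ∣ b ∨ b ∣ a) (hι : 2 < Fintype.card ι) (i : ι) (d : ℕ) (v : ι → V[X])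
    (hv : IsUnimodular v) (hi : IsUnit ((v i).coeff 0)) (hd : (v i).natDegree = d) :
    RowEquivE v (Pi.single i 1) := by
  have hthird (j : ι) : ∃ k, i ≠ k ∧ j ≠ k := by
    obtain ⟨k, hk⟩ := Finset.exists_mem_notMem_of_card_lt_card (s := {i, j})
      (t := (Finset.univ : Finset ι)) (Finset.card_le_two.trans_lt (by simpa using hι))
    simp only [Finset.mem_insert, Finset.mem_singleton, not_or] at hk
    exact ⟨k, Ne.symm hk.2.1, Ne.symm hk.2.2⟩
  induction d using Nat.strong_induction_on generalizing v with
  | _ d ih =>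
  obtain ⟨j₀, hj₀, -⟩ := hthird i
  rcases Nat.eq_zero_or_pos d with rfl | hd0
  · refine rowEquivE_single_of_isUnit hj₀ ?_
    rw [eq_C_of_natDegree_eq_zero hd]
    exact hi.map C
  have hprim (j : ι) (hij : i ≠ j) (p g : V[X]) (hp : IsUnit (p.coeff 0)) (hpd : p.natDegree = d)
      (hg : g.natDegree < d) (l : ℕ) (hl : IsUnit (g.coeff l)) (v : ι → V[X])
      (hv : IsUnimodular v) (hvi : v i = p) (hvj : v j = g) : RowEquivE v (Pi.single i 1) := by
    obtain ⟨k, hik, hjk⟩ := hthird j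
    refine descent hV (fun p g => ∀ v : ι → V[X], IsUnimodular v → v i = p → v j = g →
      RowEquivE v (Pi.single i 1)) ?_ ?_ ?_ d ?_ p g hp hpd hg l hl v hv hvi hvj
    · intro p g t H v hv hvi hvj
      have h := rowEquivE_update v hij t
      refine h.trans (H _ (hv.of_rowEquivE h) (by simp [hij, hvi]) ?_)
      simp [hvi, hvj, mul_comm]
    · intro p g t H v hv hvi hvj
      have h := rowEquivE_update v hij.symm t
      refine h.trans (H _ (hv.of_rowEquivE h) ?_ (by simp [hij.symm, hvj]))
      simp [hvi, hvj, mul_comm]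
    · intro p g hp H v hv hvi hvj
      obtain ⟨u, hu⟩ := hp.exists_right_inv
      have hp' : X * (-C u * p.divX) + v i * C u = 1 := by
        have h₁ := divX_mul_X_add p
        have h₂ : C (p.coeff 0) * C u = 1 := by rw [← C_mul, hu, C_1]
        rw [hvi]
        linear_combination h₂ - C u * h₁
      have h := rowEquivE_scale v hij hik hjk hp'
      refine h.trans (H _ (hv.of_rowEquivE h) (by simp [hij, hik, hvi]) ?_)
      simp [hjk, hvj]
    · intro p g hp hpd v hv hvi hvj
      exact ih _ hpd v hv (by rwa [hvi]) (by rw [hvi])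
  set N := Finset.univ.sup fun k => (v k).natDegree with hN
  have hdiv (k : ι) := exists_eq_mul_add_X_pow_mul hi (hd ▸ hd0) N (v k)
    ((Finset.le_sup (f := fun k => (v k).natDegree) (Finset.mem_univ k)).trans_lt (by omega))
  choose q r hqr hr using hdiv
  have h₁ := rowEquivE_add_smul v i (fun k => if k = i then 0 else - q k) (by simp)
  refine h₁.trans ?_
  set w : ι → V[X] := fun k => v k + (if k = i then 0 else - q k) * v i with hw
  have hwi : w i = v i := by simp [hw]
  have hwk (k : ι) (hk : k ≠ i) : w k = X ^ N * r k := by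
    simp only [hw, hk, if_false]
    linear_combination hqr k
  have hwu := hv.of_rowEquivE h₁
  obtain ⟨c, hc, j, hj, g, l, hrj, hg, hl⟩ := exists_content hV (T := Finset.univ.erase i)
    ⟨j₀, by simp [hj₀.symm]⟩ r (d := d) (fun k _ => hd ▸ hr k)
  have hij : i ≠ j := (Finset.ne_of_mem_erase hj).symm
  obtain ⟨k, hik, hjk⟩ := hthird j
  obtain ⟨a, b, hab⟩ := hwu.isCoprime (i := i) (c := X ^ N * C c) fun k hk => by
    rw [hwk k hk]
    exact mul_dvd_mul_left _ (hc k (by simp [hk]))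
  have h₂ := rowEquivE_scale w hij hik hjk (u := b) (w := X ^ N * C c) (z := a)
    (by linear_combination hab)
  refine h₂.trans ?_
  set w' := Function.update (Function.update w j (b * w j)) k (X ^ N * C c * w k) with hw'
  have hw'i : w' i = v i := by simp [hw', hij, hik, hwi]
  have hw'u := hwu.of_rowEquivE h₂
  have h₃ := rowEquivE_update w' hij (a * g)
  refine h₃.trans (hprim j hij (v i) g hi hd hg l hl _ (hw'u.of_rowEquivE h₃) ?_ ?_)
  · simp [hij, hw'i]
  · have : w' j = b * w j := by simp [hw', hjk]
    rw [Function.update_self, this, hwk j hij.symm, hrj, hw'i]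
    rw [hwi] at hab
    linear_combination g * hab

theorem rowEquivE_single [IsLocalRing V] (hV : ∀ a b : V, a ∣ b ∨ b ∣ a)
    (hι : 2 < Fintype.card ι) (i : ι) (v : ι → V[X]) (hv : IsUnimodular v) :
    RowEquivE v (Pi.single i 1) := by
  by_cases hi : IsUnit ((v i).coeff 0)
  · exact rowEquivE_single_of_isUnit_coeff_zero hV hι i _ v hv hi rfl
  have hv0 : IsUnimodular fun k => (v k).coeff 0 := by
    obtain ⟨u, hu⟩ := isUnimodular_iff.1 hv
    refine isUnimodular_iff.2 ⟨fun k => (u k).coeff 0, ?_⟩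
    simpa [dotProduct, mul_coeff_zero] using congrArg (coeff · 0) hu
  obtain ⟨j, hj⟩ := hv0.exists_isUnit
  have hji : j ≠ i := by rintro rfl; exact hi hj
  have h := rowEquivE_update v hji 1
  refine h.trans (rowEquivE_single_of_isUnit_coeff_zero hV hι i _ _ (hv.of_rowEquivE h) ?_ rfl)
  rw [Function.update_self, one_mul, coeff_add]
  by_contra hcon
  have := IsLocalRing.nonunits_add (b := -(v i).coeff 0) hcon (by simpa using hi)
  simp [hj] at this

end UnimodularRows

section Mennicke

variable {R : Type} [CommRing R]

/-- The Mennicke symbol of `(p, q)` is trivial: every completion of the row `(p, q)` to a `2 × 2`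
matrix of determinant one is stably elementary. -/
def MennickeTrivial (p q : R) : Prop :=
  ∀ r s, p * s - q * r = 1 → !![1, 0, 0; 0, p, q; 0, r, s] ∈ Elem (Fin 3) R

namespace MennickeTrivial

theorem of_not_isCoprime {p q : R} (h : ¬ IsCoprime p q) : MennickeTrivial p q :=
  fun r s hrs => (h ⟨s, -r, by linear_combination hrs⟩).elim

theorem of_add_right {p q : R} (t : R) (h : MennickeTrivial p (q + p * t)) :
    MennickeTrivial p q := by
  intro r s hrs
  refine Elem.of_mul_mem_right (Elem.transvection_mem (i := 1) (j := 2) (by decide) t) ?_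
  convert h r (s + r * t) (by linear_combination hrs) using 1
  ext i j
  fin_cases i <;> fin_cases j <;>
    simp [transvection, mul_apply, Fin.sum_univ_three, add_comm]

theorem of_add_left {p q : R} (t : R) (h : MennickeTrivial (p + q * t) q) :
    MennickeTrivial p q := by
  intro r s hrs
  refine Elem.of_mul_mem_right (Elem.transvection_mem (i := 2) (j := 1) (by decide) t) ?_
  convert h (r + s * t) s (by linear_combination hrs) using 1
  ext i j
  fin_cases i <;> fin_cases j <;>
    simp [transvection, mul_apply, Fin.sum_univ_three, add_comm]

theorem one_zero : MennickeTrivial (1 : R) 0 := by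
  intro r s hrs
  convert Elem.transvection_mem (i := (2 : Fin 3)) (j := 1) (by decide) r using 1
  ext i j
  fin_cases i <;> fin_cases j <;> simp [transvection]
  linear_combination hrs

theorem one_left (q : R) : MennickeTrivial 1 q :=
  of_add_right (-q) (by simpa using one_zero)

theorem of_isUnit_right {p q : R} (hq : IsUnit q) : MennickeTrivial p q := by
  obtain ⟨u, hu⟩ := hq.exists_right_inv
  refine of_add_left (u * (1 - p)) ?_
  convert one_left q using 1
  linear_combination (1 - p) * hu

theorem of_isUnit_left {p q : R} (hp : IsUnit p) : MennickeTrivial p q := by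
  obtain ⟨u, hu⟩ := hp.exists_right_inv
  refine of_add_right (u * (1 - q)) (of_isUnit_right ?_)
  convert isUnit_one using 1
  linear_combination (1 - q) * hu

theorem mul_of_neg {p c g : R} (hc : MennickeTrivial p (-c)) (hg : MennickeTrivial p g) :
    MennickeTrivial p (c * g) := by
  intro r s hrs
  have hα := Elem.submatrix_mem (Equiv.swap 0 1) (hc (-(r * g)) s (by linear_combination hrs))
  have hβ := Elem.submatrix_mem (Equiv.swap 0 2) (hg (c * r) s (by linear_combination hrs))
  have ht (i j : Fin 3) (h : i ≠ j) (a : R) := Elem.transvection_mem h a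
  have := mul_mem (mul_mem (mul_mem (mul_mem (mul_mem (ht 1 0 (by decide) (-g))
    (ht 2 1 (by decide) (r * s))) (ht 0 1 (by decide) (-(c * r)))) hα) hβ) (ht 0 2 (by decide) c)
  convert this using 1
  have e₁ : (!![1, 0, 0; 0, p, -c; 0, -(r * g), s] : Matrix (Fin 3) (Fin 3) R).submatrix
      (Equiv.swap 0 1) (Equiv.swap 0 1) = !![p, 0, -c; 0, 1, 0; -(r * g), 0, s] := by
    ext i j; fin_cases i <;> fin_cases j <;> rfl
  have e₂ : (!![1, 0, 0; 0, p, g; 0, c * r, s] : Matrix (Fin 3) (Fin 3) R).submatrix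
      (Equiv.swap 0 2) (Equiv.swap 0 2) = !![s, c * r, 0; g, p, 0; 0, 0, 1] := by
    ext i j; fin_cases i <;> fin_cases j <;> rfl
  rw [e₁, e₂]
  ext i j
  fin_cases i <;> fin_cases j <;>
    simp [transvection, mul_apply, Fin.sum_univ_three, single_apply] <;> grind

theorem neg {p g : R} (hg : MennickeTrivial p g) : MennickeTrivial p (-g) := by
  simpa using mul_of_neg (c := -1) (of_isUnit_right (by simp)) hg

theorem mul {p c g : R} (hc : MennickeTrivial p c) (hg : MennickeTrivial p g) :
    MennickeTrivial p (c * g) :=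
  mul_of_neg hc.neg hg

theorem pow {p c : R} (hc : MennickeTrivial p c) (k : ℕ) : MennickeTrivial p (c ^ k) := by
  induction k with
  | zero => exact of_isUnit_right (by simp)
  | succ k ih => rw [pow_succ]; exact ih.mul hc

end MennickeTrivial

variable {V : Type} [CommRing V]

theorem mennickeTrivial_X {p : V[X]} (hp : IsUnit (p.coeff 0)) : MennickeTrivial p X := by
  refine .of_add_left (-p.divX) (.of_isUnit_left ?_)
  convert hp.map C using 1
  linear_combination -divX_mul_X_add p

theorem MennickeTrivial.of_X_mul {p g : V[X]} (hp : IsUnit (p.coeff 0))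
    (h : MennickeTrivial p (X * g)) : MennickeTrivial p g := by
  obtain ⟨u, hu⟩ := hp.exists_right_inv
  have hC : C (p.coeff 0) * C u = 1 := by rw [← C_mul, hu, C_1]
  have hy : MennickeTrivial p (C u * p.divX) := by
    refine .of_add_left (-(C (p.coeff 0) * X)) (.of_isUnit_left ?_)
    convert hp.map C using 1
    linear_combination -divX_mul_X_add p - X * p.divX * hC
  refine .of_add_right (-(C u * g)) ?_
  convert (hy.mul h).neg using 1
  linear_combination (C u * g) * divX_mul_X_add p - g * hC

theorem mennickeTrivial_C [IsLocalRing V] (hV : ∀ a b : V, a ∣ b ∨ b ∣ a) {p : V[X]}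
    (hp : IsUnit (p.coeff 0)) (c : V) (hpc : IsCoprime p (C c)) : MennickeTrivial p (C c) := by
  obtain ⟨m, -, hm⟩ := Finset.exists_forall_dvd hV (T := Finset.range (p.natDegree + 1)) (by simp)
    p.divX.coeff
  set a := p.divX.coeff m with ha
  have hdvd (b : V) (hb : b ∣ a) : MennickeTrivial p (C b) := by
    obtain ⟨w, hw⟩ : C b ∣ p.divX := by
      refine (C_dvd_iff_dvd_coeff _ _).2 fun k => ?_
      by_cases hk : k < p.natDegree + 1
      · exact hb.trans (hm k (by simpa using hk))
      · rw [coeff_divX, coeff_eq_zero_of_natDegree_lt (by omega)]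
        exact dvd_zero _
    refine .of_add_left (-(w * X)) (.of_isUnit_left ?_)
    convert hp.map C using 1
    linear_combination -divX_mul_X_add p + X * hw
  have hpow (N : ℕ) : ∀ c, ¬ a ^ N ∣ c → MennickeTrivial p (C c) := by
    induction N with
    | zero => simp
    | succ N ih =>
      intro c hc
      rcases hV a c with ⟨e, rfl⟩ | h
      · rw [C_mul]
        refine (hdvd a dvd_rfl).mul (ih e fun h => hc ?_)
        rw [pow_succ']
        exact mul_dvd_mul_left a h
      · exact hdvd c h
  obtain ⟨N, hN⟩ : ∃ N, c ∣ a ^ N := by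
    have hu : IsUnit (p.map (Ideal.Quotient.mk (Ideal.span {c}))) := by
      obtain ⟨x, y, hxy⟩ := hpc
      refine .of_mul_eq_one (x.map (Ideal.Quotient.mk (Ideal.span {c}))) ?_
      have h := congrArg (Polynomial.map (Ideal.Quotient.mk (Ideal.span {c}))) hxy
      have h0 : Ideal.Quotient.mk (Ideal.span {c}) c = 0 :=
        Ideal.Quotient.eq_zero_iff_mem.2 (Ideal.mem_span_singleton_self c)
      simpa [h0, mul_comm] using h
    obtain ⟨N, hN⟩ := (isUnit_iff_coeff_isUnit_isNilpotent.1 hu).2 (m + 1) (by simp)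
    refine ⟨N, ?_⟩
    rwa [coeff_map, ← coeff_divX, ← map_pow, Ideal.Quotient.eq_zero_iff_mem,
      Ideal.mem_span_singleton] at hN
  by_cases hc : a ^ (N + 1) ∣ c
  · obtain ⟨z, hz⟩ := hc
    obtain ⟨w, hw⟩ := hN
    have h0 : a ^ N * (1 - a * (z * w)) = 0 := by
      rw [hz] at hw; linear_combination hw
    rcases IsLocalRing.isUnit_or_isUnit_one_sub_self (a * (z * w)) with h | h
    · have hc : IsUnit c :=
        isUnit_of_dvd_unit ⟨w, hw⟩ ((isUnit_of_mul_isUnit_left h).pow N)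
      exact .of_isUnit_right (hc.map C)
    · have : c = 0 := by rw [hz, pow_succ, h.mul_left_eq_zero.1 h0]; ring
      subst this
      exact .of_isUnit_left (by simpa [isCoprime_zero_right] using hpc)
  · exact hpow _ _ hc

theorem mennickeTrivial_of_isUnit_coeff_zero [IsLocalRing V] (hV : ∀ a b : V, a ∣ b ∨ b ∣ a)
    (d : ℕ) (p g : V[X]) (hp : IsUnit (p.coeff 0)) (hd : p.natDegree = d) :
    MennickeTrivial p g := by
  induction d using Nat.strong_induction_on generalizing p g with
  | _ d ih =>
  rcases Nat.eq_zero_or_pos d with rfl | hd0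
  · refine .of_isUnit_left ?_
    rw [eq_C_of_natDegree_eq_zero hd]
    exact hp.map C
  obtain ⟨q, r, hqr, hr⟩ := exists_eq_mul_add_X_pow_mul hp (hd ▸ hd0) g.natDegree g (by omega)
  refine .of_add_right (-q) ?_
  have hg : g + p * -q = X ^ g.natDegree * r := by linear_combination hqr
  rw [hg]
  refine ((mennickeTrivial_X hp).pow _).mul ?_
  obtain ⟨c, -, -, -, r', l, rfl, hr', hl⟩ := exists_content hV (T := {()}) (by simp) (fun _ => r)
    (d := d) (by simpa using hd ▸ hr)
  by_cases hcop : IsCoprime p (C c * r')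
  · refine (mennickeTrivial_C hV hp c hcop.of_mul_right_left).mul ?_
    exact descent hV MennickeTrivial (fun p g t => .of_add_right t) (fun p g t => .of_add_left t)
      (fun p g hp => .of_X_mul hp) d (fun p g hp hpd => ih _ hpd p g hp rfl) p r' hp hd hr' l hl
  · exact .of_not_isCoprime hcop

theorem mennickeTrivial [IsLocalRing V] (hV : ∀ a b : V, a ∣ b ∨ b ∣ a) (p g : V[X]) :
    MennickeTrivial p g := by
  by_cases hcop : IsCoprime p g
  · by_cases hp : IsUnit (p.coeff 0)
    · exact mennickeTrivial_of_isUnit_coeff_zero hV _ p g hp rfl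
    · refine .of_add_left 1 (mennickeTrivial_of_isUnit_coeff_zero hV _ _ g ?_ rfl)
      obtain ⟨x, y, hxy⟩ := hcop
      have h := congrArg (coeff · 0) hxy
      simp only [coeff_add, mul_coeff_zero, coeff_one_zero, mul_one] at h ⊢
      by_contra hcon
      have hg := IsLocalRing.nonunits_add (b := -p.coeff 0) hcon (by simpa using hp)
      rw [add_neg_cancel_comm] at hg
      have := IsLocalRing.nonunits_add (mul_mem_nonunits_right hp : x.coeff 0 * p.coeff 0 ∈ _)
        (mul_mem_nonunits_right hg : y.coeff 0 * g.coeff 0 ∈ _)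
      simp [h] at this
  · exact .of_not_isCoprime hcop

end Mennicke

section SpecialLinear

namespace Elem

variable {V : Type} [CommRing V]

theorem exists_extend_succ [IsLocalRing V] (hV : ∀ a b : V, a ∣ b ∨ b ∣ a) (n : ℕ)
    (σ : Matrix (Fin (n + 3)) (Fin (n + 3)) V[X]) (hσ : σ.det = 1) :
    ∃ ρ : Matrix (Fin (n + 2)) (Fin (n + 2)) V[X], ρ.det = 1 ∧
      (extend Fin.succ ρ ∈ Elem (Fin (n + 3)) V[X] → σ ∈ Elem (Fin (n + 3)) V[X]) := by
  have hu : IsUnimodular (σ 0) := by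
    refine isUnimodular_iff.2 ⟨fun k => σ⁻¹ k 0, ?_⟩
    have := congrFun (congrFun (mul_nonsing_inv σ (by simp [hσ])) 0) 0
    simpa [mul_apply, dotProduct] using this
  obtain ⟨E, hE, hEσ⟩ := rowEquivE_single hV (by simp) 0 (σ 0) hu
  set τ := σ * E with hτ
  have hrow : τ 0 = Pi.single 0 1 := hEσ
  have hL := transpose_mem (one_add_sum_single_mem (0 : Fin (n + 3)) (fun k => -τ k 0)
    (Finset.univ.erase 0) (by simp))
  set L : Matrix (Fin (n + 3)) (Fin (n + 3)) V[X] := (1 + ∑ k ∈ Finset.univ.erase (0 : Fin (n + 3)), single (0 : Fin (n + 3)) k (-τ k 0))ᵀ with hLdef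
  have hLτ (j k) : (L * τ) j k = τ j k + if j = 0 then 0 else -τ j 0 * τ 0 k := by
    rw [hLdef, transpose_add, transpose_one, transpose_sum, Matrix.add_mul, Matrix.one_mul,
      Finset.sum_mul, Matrix.add_apply, Matrix.sum_apply]
    simp only [transpose_single, mul_apply, single_apply, ite_and, ite_mul, zero_mul]
    simp
  have hdet : (L * τ).det = 1 := by
    rw [det_mul, hτ, det_mul, hσ, det_eq_one hE, det_eq_one hL]; simp
  have hext := extend_succ (L * τ) (by ext k; rw [hLτ]; simp [hrow])
    (fun j hj => by rw [hLτ]; simp [hj, hrow])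
  refine ⟨(L * τ).submatrix Fin.succ Fin.succ, ?_, fun h => ?_⟩
  · rwa [hext, det_extend (Fin.succ_injective _)] at hdet
  · rw [← hext] at h
    exact of_mul_mem_right hE (of_mul_mem_left hL h)

theorem mem_of_det_eq_one [IsLocalRing V] (hV : ∀ a b : V, a ∣ b ∨ b ∣ a) (n : ℕ)
    (σ : Matrix (Fin (n + 3)) (Fin (n + 3)) V[X]) (hσ : σ.det = 1) :
    σ ∈ Elem (Fin (n + 3)) V[X] := by
  induction n with
  | zero =>
    obtain ⟨ρ, hρ, h⟩ := exists_extend_succ hV 0 σ hσ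
    refine h ?_
    have := mennickeTrivial hV (ρ 0 0) (ρ 0 1) (ρ 1 0) (ρ 1 1) (by rw [← hρ, det_fin_two])
    convert this using 1
    rw [extend_succ !![1, 0, 0; 0, ρ 0 0, ρ 0 1; 0, ρ 1 0, ρ 1 1]]
    · congr 1
      ext i j; fin_cases i <;> fin_cases j <;> rfl
    · ext i; fin_cases i <;> rfl
    · intro j hj; fin_cases j <;> simp at hj ⊢
  | succ n ih =>
    obtain ⟨ρ, hρ, h⟩ := exists_extend_succ hV (n + 1) σ hσ
    exact h (extend_mem (Fin.succ_injective _) (ih ρ hρ))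

end Elem

end SpecialLinear

theorem stmt_14 {V : Type} [CommRing V] (hV : ∀ a b : V, a ∣ b ∨ b ∣ a)
    (n : ℕ) (hn : 3 ≤ n) (σ : Matrix (Fin n) (Fin n) V[X]) :
    (σ.det = 1 ↔ σ ∈ Elem (Fin n) V[X]) ∧
      (σ.det = 1 → ∃ E ∈ Elem (Fin n) V[X],
        σ * E = σ.map (fun p => C (p.eval 0))) := by
  have key (τ : Matrix (Fin n) (Fin n) V[X]) (hτ : τ.det = 1) : τ ∈ Elem (Fin n) V[X] := by
    cases subsingleton_or_nontrivial V with
    | inl _ => rw [Subsingleton.elim τ 1]; exact one_mem _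
    | inr _ =>
      have := isLocalRing_of_dvd_total hV
      obtain ⟨m, rfl⟩ := Nat.exists_eq_add_of_le' hn
      exact Elem.mem_of_det_eq_one hV m τ hτ
  refine ⟨⟨key σ, Elem.det_eq_one⟩, fun hσ => ?_⟩
  have hσ₀ : (σ.map fun p => C (p.eval 0)).det = 1 := by
    have := RingHom.map_det (C.comp (evalRingHom (0 : V))) σ
    rw [hσ, map_one] at this
    exact this.symm
  refine ⟨σ⁻¹ * σ.map fun p => C (p.eval 0), mul_mem (Elem.inv_mem (key σ hσ)) (key _ hσ₀), ?_⟩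
  rw [← Matrix.mul_assoc, mul_nonsing_inv _ (by simp [hσ]), Matrix.one_mul]
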